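/- For the specific channel W and decoding metric q given below, the rate 0.137998 nats/use is achievable under mismatched decoding: for every δ > 0 and every ε > 0, for all sufficiently large n there exists a codebook {x^(1),…,x^(M)} ⊆ {0,1}^n with M ≥ exp(n(0.137998 − δ)) whose error probability satisfies p_e ≤ ε. -/

import Mathlib

open scoped BigOperators

/-- The channel `W(y|x)` of the counter-example. -/
noncomputable def W : Fin 2 → Fin 3 → ℝ := ![![0.97, 0.03, 0], ![0.1, 0.1, 0.8]]

/-- The decoding metric `q(x,y)` of the counter-example. -/
noncomputable def q : Fin 2 → Fin 3 → ℝ := ![![1, 1, 1], ![1, 0.5, 1.36]]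

/-- The `n`-letter memoryless channel `W^n(y|x)`. -/
noncomputable def Wn (n : ℕ) (x : Fin n → Fin 2) (y : Fin n → Fin 3) : ℝ :=
  ∏ i, W (x i) (y i)

/-- The `n`-letter product decoding metric `q^n(x,y)`. -/
noncomputable def qn (n : ℕ) (x : Fin n → Fin 2) (y : Fin n → Fin 3) : ℝ :=
  ∏ i, q (x i) (y i)

/-- Error probability of codebook `c` under maximum-metric decoding,
uniform message, ties broken as errors. -/
noncomputable def pe (n M : ℕ) (c : Fin M → Fin n → Fin 2) : ℝ :=
  (1 / (M : ℝ)) * ∑ m : Fin M, ∑ y : Fin n → Fin 3,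
    Wn n (c m) y * (if ∃ j : Fin M, j ≠ m ∧ qn n (c m) y ≤ qn n (c j) y then 1 else 0)

section IidSums

variable {ι Ω : Type*} [Fintype ι] [DecidableEq ι] [Fintype Ω]

theorem sum_pi_prod (F : ι → Ω → ℝ) : ∑ f : ι → Ω, ∏ i, F i (f i) = ∏ i, ∑ a, F i a := by
  rw [Finset.prod_univ_sum, Fintype.piFinset_univ]

theorem sum_iid_eq_one (w : Ω → ℝ) (hw : ∑ a, w a = 1) : ∑ f : ι → Ω, ∏ i, w (f i) = 1 := by
  simp [sum_pi_prod fun _ => w, hw]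

/-- Isolating one coordinate of a product-weighted sum. -/
theorem sum_iid_split (w : Ω → ℝ) (i : ι) (H : Ω → ({j // j ≠ i} → Ω) → ℝ) :
    ∑ f : ι → Ω, (∏ j, w (f j)) * H (f i) (fun j => f j) =
      ∑ a, w a * ∑ g : {j // j ≠ i} → Ω, (∏ j, w (g j)) * H a g := by
  rw [Fintype.sum_equiv (Equiv.funSplitAt i Ω) _
    (fun p => w p.1 * ((∏ j, w (p.2 j)) * H p.1 p.2)), Fintype.sum_prod_type]
  · simp only [Finset.mul_sum]
  · intro f
    rw [Fintype.prod_eq_mul_prod_subtype_ne _ i]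
    simp [Equiv.funSplitAt, mul_assoc]

theorem sum_iid_single (w : Ω → ℝ) (hw : ∑ a, w a = 1) (i : ι) (h : Ω → ℝ) :
    ∑ f : ι → Ω, (∏ j, w (f j)) * h (f i) = ∑ a, w a * h a := by
  rw [sum_iid_split w i (fun a _ => h a)]
  simp [← Finset.sum_mul, sum_iid_eq_one w hw]

theorem sum_iid_pair (w : Ω → ℝ) (hw : ∑ a, w a = 1) {i j : ι} (hij : j ≠ i) (h : Ω → Ω → ℝ) :
    ∑ f : ι → Ω, (∏ k, w (f k)) * h (f i) (f j) = ∑ a, w a * ∑ b, w b * h a b := by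
  rw [sum_iid_split w i (fun a g => h a (g ⟨j, hij⟩))]
  simp only [sum_iid_single w hw]

theorem sum_iid_pairwise_le (w : Ω → ℝ) (hw0 : ∀ a, 0 ≤ w a) (hw : ∑ a, w a = 1) (i : ι)
    (a : Ω → ℝ) (b : Ω → Ω → ℝ) (hb : ∀ c c', 0 ≤ b c c') :
    ∑ f : ι → Ω, (∏ k, w (f k)) * (a (f i) + ∑ j ∈ Finset.univ.erase i, b (f i) (f j)) ≤
      ∑ c, w c * (a c + Fintype.card ι * ∑ c', w c' * b c c') := by
  have h1 : ∀ j ∈ Finset.univ.erase i, ∑ f : ι → Ω, (∏ k, w (f k)) * b (f i) (f j) =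
      ∑ c, w c * ∑ c', w c' * b c c' := fun j hj =>
    sum_iid_pair w hw (Finset.ne_of_mem_erase hj) b
  have h0 : 0 ≤ ∑ c, w c * ∑ c', w c' * b c c' := Finset.sum_nonneg fun c _ =>
    mul_nonneg (hw0 c) (Finset.sum_nonneg fun c' _ => mul_nonneg (hw0 c') (hb c c'))
  simp only [mul_add, Finset.sum_add_distrib, Finset.mul_sum (Finset.univ.erase i)]
  rw [sum_iid_single w hw i a, Finset.sum_comm, Finset.sum_congr rfl h1, Finset.sum_const,
    nsmul_eq_mul]
  have h2 : ((Finset.univ.erase i).card : ℝ) ≤ Fintype.card ι := by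
    exact_mod_cast Finset.card_le_univ _
  have h3 : ∑ c, w c * ((Fintype.card ι : ℝ) * ∑ c', w c' * b c c') =
      Fintype.card ι * ∑ c, w c * ∑ c', w c' * b c c' := by
    rw [Finset.mul_sum]; exact Finset.sum_congr rfl fun c _ => by ring
  rw [h3]
  gcongr

/-- Chernoff bound: the lower tail of an i.i.d. sum decays geometrically. -/
theorem exists_chernoff (w : Ω → ℝ) (hw0 : ∀ a, 0 ≤ w a) (hw : ∑ a, w a = 1) (f : Ω → ℝ)
    {η : ℝ} (hη : 0 < η) :
    ∃ t : ℝ, 0 ≤ t ∧ ∃ r : ℝ, 0 ≤ r ∧ r < 1 ∧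
      ∑ a, w a * Real.exp (t * ((∑ b, w b * f b) - η - f a)) ≤ r := by
  set μ := ∑ b, w b * f b with hμ
  obtain ⟨B, hB⟩ : ∃ B : ℝ, ∀ a, |μ - η - f a| ≤ B := by
    refine ⟨∑ a, |μ - η - f a|, fun a => ?_⟩
    exact Finset.single_le_sum (f := fun a => |μ - η - f a|) (fun _ _ => abs_nonneg _)
      (Finset.mem_univ a)
  set C := max B 1 with hC
  have hC1 : 1 ≤ C := le_max_right _ _
  have hBC : ∀ a, |μ - η - f a| ≤ C := fun a => (hB a).trans (le_max_left _ _)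
  set t := min (1 / C) (η / (2 * C ^ 2)) with ht
  have ht0 : 0 < t := by positivity
  have ht1 : t * C ≤ 1 := by
    calc t * C ≤ 1 / C * C := by gcongr; exact min_le_left _ _
      _ = 1 := by field_simp
  have ht2 : t * C ^ 2 ≤ η / 2 := by
    calc t * C ^ 2 ≤ η / (2 * C ^ 2) * C ^ 2 := by gcongr; exact min_le_right _ _
      _ = η / 2 := by field_simp
  refine ⟨t, ht0.le, ∑ a, w a * Real.exp (t * (μ - η - f a)), Finset.sum_nonneg fun a _ =>
    mul_nonneg (hw0 a) (Real.exp_pos _).le, ?_, le_rfl⟩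
  have key : ∀ a, w a * Real.exp (t * (μ - η - f a)) ≤
      w a * (1 + t ^ 2 * C ^ 2 + t * (μ - η)) - t * (w a * f a) := by
    intro a
    have h1 : |t * (μ - η - f a)| ≤ 1 := by
      rw [abs_mul, abs_of_pos ht0]
      exact (mul_le_mul_of_nonneg_left (hBC a) ht0.le).trans ht1
    have h2 := (abs_le.1 (Real.abs_exp_sub_one_sub_id_le h1)).2
    have h3 : (μ - η - f a) ^ 2 ≤ C ^ 2 := sq_le_sq' (abs_le.1 (hBC a)).1 (abs_le.1 (hBC a)).2
    have h4 : (t * (μ - η - f a)) ^ 2 ≤ t ^ 2 * C ^ 2 := by rw [mul_pow]; gcongr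
    have := mul_le_mul_of_nonneg_left
      (show Real.exp (t * (μ - η - f a)) ≤ 1 + t * (μ - η - f a) + t ^ 2 * C ^ 2 by linarith)
      (hw0 a)
    linarith
  calc ∑ a, w a * Real.exp (t * (μ - η - f a))
      ≤ ∑ a, (w a * (1 + t ^ 2 * C ^ 2 + t * (μ - η)) - t * (w a * f a)) :=
        Finset.sum_le_sum fun a _ => key a
    _ = 1 + t * (t * C ^ 2) - t * η := by
        rw [Finset.sum_sub_distrib, ← Finset.sum_mul, ← Finset.mul_sum, hw, ← hμ]; ring
    _ < 1 := by nlinarith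

end IidSums

section OneShot

open Classical in
/-- Error of message `m` of the superposition codebook `C`, where `T` is a set of atypical triples
and `Z m j y` says that `j` is confusable with `m` at output `y`. -/
noncomputable def codeError {ι κ α β γ : Type*} [Fintype γ] (K : α → β → γ → ℝ)
    (T : α × β → γ → Prop) (Z : α × β → α × β → γ → Prop) (C : ι → α × (κ → β))
    (m : ι × κ) : ℝ :=
  ∑ y, K (C m.1).1 ((C m.1).2 m.2) y *
    if T ((C m.1).1, (C m.1).2 m.2) y ∨ ∃ j : ι × κ, j ≠ m ∧
      Z ((C m.1).1, (C m.1).2 m.2) ((C j.1).1, (C j.1).2 j.2) y then 1 else 0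

variable {ι κ α β γ : Type*} [Fintype ι] [DecidableEq ι] [Fintype κ] [DecidableEq κ] [Fintype γ]

open Classical in
theorem codeError_le_union (K : α → β → γ → ℝ) (hK0 : ∀ u v y, 0 ≤ K u v y)
    (T : α × β → γ → Prop) (Z : α × β → α × β → γ → Prop) (C : ι → α × (κ → β)) (i : ι) (k : κ) :
    codeError K T Z C (i, k) ≤
      ((∑ y, K (C i).1 ((C i).2 k) y * if T ((C i).1, (C i).2 k) y then 1 else 0) +
        ∑ l ∈ Finset.univ.erase k, ∑ y, K (C i).1 ((C i).2 k) y *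
          if ¬ T ((C i).1, (C i).2 k) y ∧ Z ((C i).1, (C i).2 k) ((C i).1, (C i).2 l) y
          then 1 else 0) +
      ∑ j ∈ Finset.univ.erase i, ∑ y, K (C i).1 ((C i).2 k) y *
          if ¬ T ((C i).1, (C i).2 k) y ∧ ∃ l, Z ((C i).1, (C i).2 k) ((C j).1, (C j).2 l) y
          then 1 else 0 := by
  rw [codeError, Finset.sum_comm, Finset.sum_comm (s := Finset.univ.erase i),
    ← Finset.sum_add_distrib, ← Finset.sum_add_distrib]
  refine Finset.sum_le_sum fun y _ => ?_
  rw [← Finset.mul_sum, ← Finset.mul_sum, ← mul_add, ← mul_add]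
  refine mul_le_mul_of_nonneg_left ?_ (hK0 _ _ _)
  have n1 : ∀ l, (0 : ℝ) ≤ if ¬ T ((C i).1, (C i).2 k) y ∧
      Z ((C i).1, (C i).2 k) ((C i).1, (C i).2 l) y then 1 else 0 := fun l => by positivity
  have n2 : ∀ j, (0 : ℝ) ≤ if ¬ T ((C i).1, (C i).2 k) y ∧
      ∃ l, Z ((C i).1, (C i).2 k) ((C j).1, (C j).2 l) y then 1 else 0 := fun j => by positivity
  have s1 := Finset.sum_nonneg (s := Finset.univ.erase k) fun l _ => n1 l
  have s2 := Finset.sum_nonneg (s := Finset.univ.erase i) fun j _ => n2 j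
  by_cases hT : T ((C i).1, (C i).2 k) y
  · simp only [hT, true_or, if_true] at s1 s2 ⊢
    linarith
  · by_cases hZ : ∃ j : ι × κ, j ≠ (i, k) ∧ Z ((C i).1, (C i).2 k) ((C j.1).1, (C j.1).2 j.2) y
    · rw [if_pos (Or.inr hZ), if_neg hT]
      obtain ⟨⟨j, l⟩, hne, hZ⟩ := hZ
      by_cases hj : j = i
      · subst hj
        have hl : l ≠ k := fun h => hne (by rw [h])
        have := Finset.single_le_sum (fun l _ => n1 l)
          (Finset.mem_erase.2 ⟨hl, Finset.mem_univ l⟩)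
        rw [if_pos ⟨hT, hZ⟩] at this
        linarith
      · have := Finset.single_le_sum (fun j _ => n2 j)
          (Finset.mem_erase.2 ⟨hj, Finset.mem_univ j⟩)
        rw [if_pos ⟨hT, l, hZ⟩] at this
        linarith
    · rw [if_neg (not_or.2 ⟨hT, hZ⟩), if_neg hT]
      linarith

variable [Fintype α] [Fintype β]

open Classical in
/-- The cloud-level union bound. -/
theorem sum_exists_le (P : β → ℝ) (hP0 : ∀ v, 0 ≤ P v) (hP : ∑ v, P v = 1) (z : β → Prop) :
    ∑ g : κ → β, (∏ l, P (g l)) * (if ∃ l, z (g l) then 1 else 0) ≤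
      min 1 (Fintype.card κ * ∑ v, P v * if z v then 1 else 0) := by
  have hw : ∀ g : κ → β, 0 ≤ ∏ l, P (g l) := fun g => Finset.prod_nonneg fun l _ => hP0 _
  refine le_min ?_ ?_
  · calc ∑ g : κ → β, (∏ l, P (g l)) * (if ∃ l, z (g l) then (1 : ℝ) else 0)
        ≤ ∑ g : κ → β, ∏ l, P (g l) := by
          refine Finset.sum_le_sum fun g _ => mul_le_of_le_one_right (hw g) ?_
          split_ifs <;> norm_num
      _ = 1 := sum_iid_eq_one P hP
  · calc ∑ g : κ → β, (∏ l, P (g l)) * (if ∃ l, z (g l) then (1 : ℝ) else 0)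
        ≤ ∑ g : κ → β, (∏ l, P (g l)) * ∑ l, (if z (g l) then (1 : ℝ) else 0) := by
          refine Finset.sum_le_sum fun g _ => mul_le_mul_of_nonneg_left ?_ (hw g)
          split_ifs with h
          · obtain ⟨l, hl⟩ := h
            have := Finset.single_le_sum (f := fun l => if z (g l) then (1 : ℝ) else 0)
              (fun _ _ => by positivity) (Finset.mem_univ l)
            simpa [hl] using this
          · positivity
      _ = ∑ l : κ, ∑ v, P v * (if z v then (1 : ℝ) else 0) := by
          simp only [Finset.mul_sum]
          rw [Finset.sum_comm]
          refine Finset.sum_congr rfl fun l _ => ?_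
          rw [sum_iid_single P hP l (fun v => if z v then (1 : ℝ) else 0)]
      _ = _ := by simp

open Classical in
/-- One-shot random-coding bound for the superposition ensemble. -/
theorem exists_superposition_code (P : α → ℝ) (hP0 : ∀ u, 0 ≤ P u)
    (hP : ∑ u, P u = 1) (R : β → ℝ) (hR0 : ∀ v, 0 ≤ R v) (hR : ∑ v, R v = 1)
    (K : α → β → γ → ℝ) (hK0 : ∀ u v y, 0 ≤ K u v y) (hK : ∀ u v, ∑ y, K u v y = 1)
    (T : α × β → γ → Prop) (Z : α × β → α × β → γ → Prop) {ε₁ ε₂ ε₃ : ℝ}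
    (hε₂ : 0 ≤ ε₂) (hε₃ : 0 ≤ ε₃)
    (hT : ∑ u, P u * ∑ v, R v * ∑ y, K u v y * (if T (u, v) y then 1 else 0) ≤ ε₁)
    (hsat : ∀ u v y, ¬ T (u, v) y →
      Fintype.card κ * ∑ v', R v' * (if Z (u, v) (u, v') y then 1 else 0) ≤ ε₂)
    (hcloud : ∀ u v y, ¬ T (u, v) y →
      Fintype.card ι * ∑ u', P u' * min 1 (Fintype.card κ *
        ∑ v', R v' * (if Z (u, v) (u', v') y then 1 else 0)) ≤ ε₃) :
    ∃ C : ι → α × (κ → β), ∑ m, codeError K T Z C m ≤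
      Fintype.card (ι × κ) * (ε₁ + ε₂ + ε₃) := by
  set w : α × (κ → β) → ℝ := fun c => P c.1 * ∏ l, R (c.2 l) with hw
  have hw0 : ∀ c, 0 ≤ w c := fun c => mul_nonneg (hP0 _) (Finset.prod_nonneg fun _ _ => hR0 _)
  have hsplit : ∀ F : α × (κ → β) → ℝ,
      ∑ c, w c * F c = ∑ u, P u * ∑ g : κ → β, (∏ l, R (g l)) * F (u, g) := fun F => by
    simp only [hw, Fintype.sum_prod_type, Finset.mul_sum, mul_assoc]
  have hw1 : ∑ c, w c = 1 := by
    have := hsplit fun _ => 1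
    simpa [sum_iid_eq_one R hR, hP] using this
  have hKle : ∀ u v (s : γ → ℝ) (e : ℝ), (∀ y, s y ≤ e) → ∑ y, K u v y * s y ≤ e := by
    intro u v s e hs
    calc ∑ y, K u v y * s y ≤ ∑ y, K u v y * e :=
          Finset.sum_le_sum fun y _ => mul_le_mul_of_nonneg_left (hs y) (hK0 u v y)
      _ = e := by rw [← Finset.sum_mul, hK, one_mul]
  have hpt : ∀ m : ι × κ, ∑ C : ι → α × (κ → β), (∏ i, w (C i)) * codeError K T Z C m ≤
      ε₁ + ε₂ + ε₃ := by
    rintro ⟨i, k⟩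
    set F : α → β → ℝ := fun u v => ∑ y, K u v y * if T (u, v) y then 1 else 0 with hF
    set H : α → β → β → ℝ := fun u v v' =>
      ∑ y, K u v y * if ¬ T (u, v) y ∧ Z (u, v) (u, v') y then 1 else 0 with hH
    set b : α × (κ → β) → α × (κ → β) → ℝ := fun c c' => ∑ y, K c.1 (c.2 k) y *
      if ¬ T (c.1, c.2 k) y ∧ ∃ l, Z (c.1, c.2 k) (c'.1, c'.2 l) y then 1 else 0 with hb
    have hb0 : ∀ c c', 0 ≤ b c c' := fun c c' => Finset.sum_nonneg fun y _ =>
      mul_nonneg (hK0 _ _ _) (by positivity)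
    have hH0 : ∀ u v v', 0 ≤ H u v v' := fun u v v' => Finset.sum_nonneg fun y _ =>
      mul_nonneg (hK0 _ _ _) (by positivity)
    have hcl : ∀ c, Fintype.card ι * ∑ c', w c' * b c c' ≤ ε₃ := by
      intro c
      have : (Fintype.card ι : ℝ) * ∑ c', w c' * b c c' = ∑ y, K c.1 (c.2 k) y *
          (Fintype.card ι * ∑ c', w c' *
            if ¬ T (c.1, c.2 k) y ∧ ∃ l, Z (c.1, c.2 k) (c'.1, c'.2 l) y then 1 else 0) := by
        simp only [hb, Finset.mul_sum]
        rw [Finset.sum_comm]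
        exact Finset.sum_congr rfl fun _ _ => Finset.sum_congr rfl fun _ _ => by ring
      rw [this]
      refine hKle _ _ _ _ fun y => ?_
      by_cases hTy : T (c.1, c.2 k) y
      · simpa [hTy] using hε₃
      · refine le_trans ?_ (hcloud _ _ _ hTy)
        rw [hsplit]
        simp only [hTy, not_false_eq_true, true_and]
        gcongr with u' _
        · exact hP0 u'
        · exact sum_exists_le (κ := κ) R hR0 hR fun v' => Z (c.1, c.2 k) (u', v') y
    have hsa : ∀ u v, Fintype.card κ * ∑ v', R v' * H u v v' ≤ ε₂ := by
      intro u v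
      have : (Fintype.card κ : ℝ) * ∑ v', R v' * H u v v' = ∑ y, K u v y *
          (Fintype.card κ * ∑ v', R v' *
            if ¬ T (u, v) y ∧ Z (u, v) (u, v') y then 1 else 0) := by
        simp only [hH, Finset.mul_sum]
        rw [Finset.sum_comm]
        exact Finset.sum_congr rfl fun _ _ => Finset.sum_congr rfl fun _ _ => by ring
      rw [this]
      refine hKle _ _ _ _ fun y => ?_
      by_cases hTy : T (u, v) y
      · simpa [hTy] using hε₂
      · simpa [hTy] using hsat _ _ _ hTy
    calc ∑ C : ι → α × (κ → β), (∏ i, w (C i)) * codeError K T Z C (i, k)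
        ≤ ∑ C : ι → α × (κ → β), (∏ i, w (C i)) *
            ((F (C i).1 ((C i).2 k) + ∑ l ∈ Finset.univ.erase k,
              H (C i).1 ((C i).2 k) ((C i).2 l)) + ∑ j ∈ Finset.univ.erase i, b (C i) (C j)) :=
          Finset.sum_le_sum fun C _ => mul_le_mul_of_nonneg_left
            (codeError_le_union K hK0 T Z C i k) (Finset.prod_nonneg fun _ _ => hw0 _)
      _ ≤ ∑ c, w c * ((F c.1 (c.2 k) + ∑ l ∈ Finset.univ.erase k, H c.1 (c.2 k) (c.2 l)) +
            Fintype.card ι * ∑ c', w c' * b c c') :=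
          sum_iid_pairwise_le w hw0 hw1 i
            (fun c => F c.1 (c.2 k) + ∑ l ∈ Finset.univ.erase k, H c.1 (c.2 k) (c.2 l)) b hb0
      _ ≤ ∑ c, w c * ((F c.1 (c.2 k) + ∑ l ∈ Finset.univ.erase k, H c.1 (c.2 k) (c.2 l)) +
            ε₃) := by
          gcongr with c _
          · exact hw0 c
          · exact hcl c
      _ = (∑ u, P u * ∑ g : κ → β, (∏ l, R (g l)) *
            (F u (g k) + ∑ l ∈ Finset.univ.erase k, H u (g k) (g l))) + ε₃ := by
          rw [← hsplit fun c => F c.1 (c.2 k) + ∑ l ∈ Finset.univ.erase k, H c.1 (c.2 k) (c.2 l)]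
          simp only [mul_add _ _ ε₃, Finset.sum_add_distrib (g := fun c => w c * ε₃),
            ← Finset.sum_mul, hw1, one_mul]
      _ ≤ (∑ u, P u * ∑ v, R v * (F u v + ε₂)) + ε₃ := by
          gcongr with u _
          · exact hP0 u
          refine (sum_iid_pairwise_le R hR0 hR k (F u) (H u) (hH0 u)).trans ?_
          gcongr with v _
          · exact hR0 v
          · exact hsa u v
      _ = (∑ u, P u * ∑ v, R v * F u v) + ε₂ + ε₃ := by
          simp only [mul_add, Finset.sum_add_distrib, ← Finset.sum_mul, hR, hP, one_mul]
      _ ≤ ε₁ + ε₂ + ε₃ := by gcongr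
  by_contra! hcon
  have hsum : ∑ C : ι → α × (κ → β), (∏ i, w (C i)) * ∑ m, codeError K T Z C m ≤
      Fintype.card (ι × κ) * (ε₁ + ε₂ + ε₃) := by
    simp only [Finset.mul_sum]
    rw [Finset.sum_comm]
    exact (Finset.sum_le_sum fun m _ => hpt m).trans_eq (by simp [mul_add])
  have h1 : ∑ C : ι → α × (κ → β), ∏ i, w (C i) = 1 := sum_iid_eq_one w hw1
  obtain ⟨C, -, hC⟩ : ∃ C ∈ Finset.univ, (0 : ℝ) < ∏ i, w ((C : ι → α × (κ → β)) i) := by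
    by_contra! h
    linarith [Finset.sum_nonpos h]
  refine absurd hsum (not_le.2 ?_)
  calc (Fintype.card (ι × κ) : ℝ) * (ε₁ + ε₂ + ε₃)
      = ∑ C : ι → α × (κ → β), (∏ i, w (C i)) * (Fintype.card (ι × κ) * (ε₁ + ε₂ + ε₃)) := by
        rw [← Finset.sum_mul, h1, one_mul]
    _ < ∑ C : ι → α × (κ → β), (∏ i, w (C i)) * ∑ m, codeError K T Z C m :=
        Finset.sum_lt_sum (fun C _ => mul_le_mul_of_nonneg_left (hcon C).le
          (Finset.prod_nonneg fun _ _ => hw0 _)) ⟨C, Finset.mem_univ _,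
          mul_lt_mul_of_pos_left (hcon C) hC⟩

end OneShot

section SuperpositionCoding

open Filter Topology

variable {A B Y : Type*} [Fintype A] [Fintype B] [Fintype Y] {N : ℕ}

theorem sum_triple_prod (pA : A → ℝ) (pB : B → ℝ) (K E : A → B → Y → ℝ) :
    ∑ u : Fin N → A, (∏ i, pA (u i)) * ∑ v : Fin N → B, (∏ i, pB (v i)) *
      ∑ y : Fin N → Y, (∏ i, K (u i) (v i) (y i)) * ∏ i, E (u i) (v i) (y i) =
    (∑ a, pA a * ∑ b, pB b * ∑ y, K a b y * E a b y) ^ N := by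
  have h1 : ∀ (u : Fin N → A) (v : Fin N → B),
      ∑ y : Fin N → Y, (∏ i, K (u i) (v i) (y i)) * ∏ i, E (u i) (v i) (y i) =
      ∏ i, ∑ y, K (u i) (v i) y * E (u i) (v i) y := fun u v => by
    rw [← sum_pi_prod (fun i y => K (u i) (v i) y * E (u i) (v i) y)]
    simp only [Finset.prod_mul_distrib]
  have h2 : ∀ u : Fin N → A, ∑ v : Fin N → B, (∏ i, pB (v i)) *
      ∏ i, ∑ y, K (u i) (v i) y * E (u i) (v i) y =
      ∏ i, ∑ b, pB b * ∑ y, K (u i) b y * E (u i) b y := fun u => by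
    rw [← sum_pi_prod (fun i b => pB b * ∑ y, K (u i) b y * E (u i) b y)]
    simp only [Finset.prod_mul_distrib]
  have h3 : ∑ u : Fin N → A, (∏ i, pA (u i)) *
      ∏ i, ∑ b, pB b * ∑ y, K (u i) b y * E (u i) b y =
      ∏ _i : Fin N, ∑ a, pA a * ∑ b, pB b * ∑ y, K a b y * E a b y := by
    rw [← sum_pi_prod (fun (_ : Fin N) a => pA a * ∑ b, pB b * ∑ y, K a b y * E a b y)]
    simp only [Finset.prod_mul_distrib]
  simp only [h1, h2, h3, Finset.prod_const, Finset.card_univ, Fintype.card_fin]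

open Classical in
/-- The lower tail of a memoryless sum has exponentially small probability. -/
theorem exists_tail_bound (pA : A → ℝ) (hA0 : ∀ a, 0 ≤ pA a) (hA : ∑ a, pA a = 1)
    (pB : B → ℝ) (hB0 : ∀ b, 0 ≤ pB b) (hB : ∑ b, pB b = 1)
    (K : A → B → Y → ℝ) (hK0 : ∀ a b y, 0 ≤ K a b y) (hK : ∀ a b, ∑ y, K a b y = 1)
    (f : A → B → Y → ℝ) {η : ℝ} (hη : 0 < η) :
    ∃ r : ℝ, 0 ≤ r ∧ r < 1 ∧ ∀ N : ℕ,
      ∑ u : Fin N → A, (∏ i, pA (u i)) * ∑ v : Fin N → B, (∏ i, pB (v i)) *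
        ∑ y : Fin N → Y, (∏ i, K (u i) (v i) (y i)) *
          (if ∑ i, f (u i) (v i) (y i) <
            N * ((∑ a, pA a * ∑ b, pB b * ∑ y, K a b y * f a b y) - η) then 1 else 0) ≤ r ^ N := by
  have hw : ∀ F : A → B → Y → ℝ, ∑ p : A × B × Y, pA p.1 * pB p.2.1 * K p.1 p.2.1 p.2.2 *
      F p.1 p.2.1 p.2.2 = ∑ a, pA a * ∑ b, pB b * ∑ y, K a b y * F a b y := fun F => by
    simp only [Fintype.sum_prod_type, Finset.mul_sum, mul_assoc]
  obtain ⟨t, ht, r, hr0, hr1, h⟩ := exists_chernoff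
    (fun p : A × B × Y => pA p.1 * pB p.2.1 * K p.1 p.2.1 p.2.2)
    (fun p => mul_nonneg (mul_nonneg (hA0 _) (hB0 _)) (hK0 _ _ _))
    (by simpa [hK, hB, hA] using hw fun _ _ _ => 1) (fun p => f p.1 p.2.1 p.2.2) hη
  refine ⟨r, hr0, hr1, fun N => ?_⟩
  rw [hw f] at h
  set μ := ∑ a, pA a * ∑ b, pB b * ∑ y, K a b y * f a b y
  rw [hw fun a b y => Real.exp (t * (μ - η - f a b y))] at h
  refine le_trans ?_ (pow_le_pow_left₀ (Finset.sum_nonneg fun a _ => mul_nonneg (hA0 a) <|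
    Finset.sum_nonneg fun b _ => mul_nonneg (hB0 b) <| Finset.sum_nonneg fun y _ =>
    mul_nonneg (hK0 a b y) (Real.exp_pos _).le) h N)
  rw [← sum_triple_prod]
  gcongr with u _ v _ y _
  · exact Finset.prod_nonneg fun _ _ => hA0 _
  · exact Finset.prod_nonneg fun _ _ => hB0 _
  · exact Finset.prod_nonneg fun _ _ => hK0 _ _ _
  · rw [← Real.exp_sum, ← Finset.mul_sum]
    split_ifs with hlt
    · refine Real.one_le_exp (mul_nonneg ht ?_)
      simp only [Finset.sum_sub_distrib, Finset.sum_const, Finset.card_univ, Fintype.card_fin,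
        nsmul_eq_mul]
      linarith
    · exact (Real.exp_pos _).le

theorem prod_eq_exp_sum_log {ι : Type*} [Fintype ι] {x : ι → ℝ} (hx : ∀ i, 0 < x i) :
    ∏ i, x i = Real.exp (∑ i, Real.log (x i)) := by
  rw [Real.exp_sum]
  exact Finset.prod_congr rfl fun i _ => (Real.exp_log (hx i)).symm

/-- The output partition function of the satellite law `pB`, the metric `g` and the tilt `t`. -/
noncomputable def tiltedSum {A B Y : Type*} [Fintype B] (pB : B → ℝ) (g : A → B → Y → ℝ)
    (t : A → B → ℝ) (a : A) (y : Y) : ℝ :=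
  ∑ b, pB b * (g a b y * Real.exp (t a b))

open Classical in
/-- Markov bound for a competing satellite word under the tilt `t`. -/
theorem sum_tilted_le {A B Y : Type*} [Fintype B] (pB : B → ℝ) (hB0 : ∀ b, 0 ≤ pB b)
    (g : A → B → Y → ℝ) (hg : ∀ a b y, 0 < g a b y) (t : A → B → ℝ) (u : Fin N → A)
    (y : Fin N → Y) {c G : ℝ} (hG : 0 < G) (z : (Fin N → B) → Prop)
    (hz : ∀ v, z v → c ≤ ∑ i, t (u i) (v i) ∧ G ≤ ∏ i, g (u i) (v i) (y i)) :
    ∑ v : Fin N → B, (∏ i, pB (v i)) * (if z v then 1 else 0) ≤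
      Real.exp (-c) / G * ∏ i, tiltedSum pB g t (u i) (y i) := by
  simp only [tiltedSum]
  rw [← sum_pi_prod fun i b => pB b * (g (u i) b (y i) * Real.exp (t (u i) b)), Finset.mul_sum]
  refine Finset.sum_le_sum fun v _ => ?_
  have hgp : 0 < ∏ i, g (u i) (v i) (y i) := Finset.prod_pos fun i _ => hg _ _ _
  rw [Finset.prod_mul_distrib, Finset.prod_mul_distrib, ← Real.exp_sum, mul_left_comm]
  refine mul_le_mul_of_nonneg_left ?_ (Finset.prod_nonneg fun i _ => hB0 _)
  split_ifs with h
  · obtain ⟨h1, h2⟩ := hz v h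
    have e1 : Real.exp (-c) / G * ((∏ i, g (u i) (v i) (y i)) *
        Real.exp (∑ i, t (u i) (v i))) = (∏ i, g (u i) (v i) (y i)) / G *
        Real.exp (∑ i, t (u i) (v i) - c) := by
      rw [sub_eq_add_neg, Real.exp_add]; ring
    rw [e1]
    exact one_le_mul_of_one_le_of_one_le ((one_le_div hG).2 h2)
      (Real.one_le_exp (by linarith))
  · positivity

theorem min_one_le_rpow {z ρ : ℝ} (hz : 0 ≤ z) (hρ0 : 0 ≤ ρ) (hρ1 : ρ ≤ 1) :
    min 1 z ≤ z ^ ρ := by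
  rcases le_total z 1 with h | h
  · refine (min_le_right _ _).trans ?_
    simpa using Real.rpow_le_rpow_of_exponent_ge' hz h hρ0 hρ1
  · exact (min_le_left _ _).trans (Real.one_le_rpow h hρ0)

theorem sum_weight_pos (p : A → ℝ) (hp0 : ∀ a, 0 ≤ p a) (hp : ∑ a, p a = 1) {f : A → ℝ}
    (hf : ∀ a, 0 < f a) : 0 < ∑ a, p a * f a := by
  obtain ⟨a, -, ha⟩ : ∃ a ∈ Finset.univ, 0 < p a := by
    by_contra! h
    linarith [Finset.sum_nonpos h]
  exact Finset.sum_pos' (fun a _ => mul_nonneg (hp0 a) (hf a).le)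
    ⟨a, Finset.mem_univ a, mul_pos ha (hf a)⟩

theorem ceil_exp_le {x : ℝ} (hx : 0 ≤ x) : (⌈Real.exp x⌉₊ : ℝ) ≤ 2 * Real.exp x := by
  linarith [(Nat.ceil_lt_add_one (Real.exp_pos x).le).le, Real.one_le_exp hx]

open Classical in
/-- Expurgating a superposition codebook of small average error. -/
theorem exists_subcode {ι κ α β γ : Type*} [Fintype ι] [Fintype κ] [Fintype γ]
    (K : α → β → γ → ℝ) (hK0 : ∀ u v y, 0 ≤ K u v y) (hK : ∀ u v, ∑ y, K u v y = 1)
    (G : α → β → γ → ℝ) (good : α × β → Prop) (T : α × β → γ → Prop)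
    (hT : ∀ w y, ¬ good w → T w y) (C : ι → α × (κ → β)) {ε : ℝ} (hε0 : 0 < ε) (hε1 : ε < 1)
    (hC : ∑ m, codeError K T (fun m j y => good j ∧ G m.1 m.2 y ≤ G j.1 j.2 y) C m ≤
      Fintype.card (ι × κ) * (ε / 2)) :
    ∃ M : ℕ, ∃ c : Fin M → α × β, (Fintype.card (ι × κ) : ℝ) / 2 ≤ M ∧
      ∀ m, ∑ y, K (c m).1 (c m).2 y *
        (if ∃ j, j ≠ m ∧ G (c m).1 (c m).2 y ≤ G (c j).1 (c j).2 y then 1 else 0) ≤ ε := by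
  set Z : α × β → α × β → γ → Prop := fun m j y => good j ∧ G m.1 m.2 y ≤ G j.1 j.2 y with hZ
  set J : Finset (ι × κ) := Finset.univ.filter fun m => codeError K T Z C m ≤ ε with hJ
  set word : ι × κ → α × β := fun m => ((C m.1).1, (C m.1).2 m.2) with hword
  have herr0 : ∀ m, 0 ≤ codeError K T Z C m := fun m => Finset.sum_nonneg fun y _ =>
    mul_nonneg (hK0 _ _ _) (by positivity)
  have hgood : ∀ m ∈ J, good (word m) := by
    intro m hm
    by_contra hbad
    have h1 : codeError K T Z C m = 1 := by
      refine Eq.trans (Finset.sum_congr rfl fun y _ => ?_) (hK (C m.1).1 ((C m.1).2 m.2))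
      rw [if_pos (Or.inl (hT _ y hbad)), mul_one]
    have h2 := (Finset.mem_filter.1 hm).2
    linarith
  have hcard : (Fintype.card (ι × κ) : ℝ) / 2 ≤ J.card := by
    have h1 : ((Finset.univ.filter fun m => ¬ codeError K T Z C m ≤ ε).card : ℝ) * ε ≤
        ∑ m, codeError K T Z C m := by
      rw [← nsmul_eq_mul]
      refine (Finset.card_nsmul_le_sum _ _ _ fun m hm => ?_).trans
        (Finset.sum_le_sum_of_subset_of_nonneg (Finset.filter_subset _ _) fun m _ _ => herr0 m)
      exact (not_le.1 (Finset.mem_filter.1 hm).2).le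
    have h2 : (J.card : ℝ) + (Finset.univ.filter fun m => ¬ codeError K T Z C m ≤ ε).card =
        Fintype.card (ι × κ) := by
      exact_mod_cast Finset.card_filter_add_card_filter_not (s := Finset.univ)
        (fun m => codeError K T Z C m ≤ ε)
    have h3 := h1.trans hC
    have h4 : ((Finset.univ.filter fun m => ¬ codeError K T Z C m ≤ ε).card : ℝ) ≤
        Fintype.card (ι × κ) / 2 := by
      refine le_of_mul_le_mul_right (h3.trans_eq ?_) hε0
      ring
    linarith
  refine ⟨J.card, fun m => word (J.equivFin.symm m), hcard, fun m => ?_⟩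
  refine le_trans (Finset.sum_le_sum fun y _ => mul_le_mul_of_nonneg_left ?_ (hK0 _ _ _))
    (Finset.mem_filter.1 (J.equivFin.symm m).2).2
  split_ifs with h1 h2 h2
  · exact le_rfl
  · refine absurd (Or.inr ?_) h2
    obtain ⟨j, hj, hle⟩ := h1
    exact ⟨J.equivFin.symm j, fun h => hj (J.equivFin.symm.injective (Subtype.ext h)),
      hgood _ (J.equivFin.symm j).2, hle⟩
  · exact zero_le_one
  · exact le_rfl

theorem tiltedSum_pos {A B Y : Type*} [Fintype B] (pB : B → ℝ) (hB0 : ∀ b, 0 ≤ pB b)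
    (hB : ∑ b, pB b = 1) (g : A → B → Y → ℝ) (hg : ∀ a b y, 0 < g a b y) (t : A → B → ℝ)
    (a : A) (y : Y) : 0 < tiltedSum pB g t a y :=
  sum_weight_pos pB hB0 hB fun _ => mul_pos (hg _ _ _) (Real.exp_pos _)

open Classical in
theorem satellite_union_le {A B Y : Type*} [Fintype B] (pB : B → ℝ) (hB0 : ∀ b, 0 ≤ pB b)
    (hB : ∑ b, pB b = 1)
    (g : A → B → Y → ℝ) (hg : ∀ a b y, 0 < g a b y) (t : A → B → ℝ)
    (u : Fin N → A) (v : Fin N → B) (y : Fin N → Y) {R m μ η M : ℝ}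
    (hM : M ≤ 2 * Real.exp (N * R)) (hη : R + 3 * η ≤ m + μ)
    (hf : N * (μ - η) ≤ ∑ i, (Real.log (g (u i) (v i) (y i)) -
      Real.log (tiltedSum pB g t (u i) (y i))))
    (z : (Fin N → B) → Prop) (hz : ∀ v', z v' → N * (m - η) ≤ ∑ i, t (u i) (v' i) ∧
      ∏ i, g (u i) (v i) (y i) ≤ ∏ i, g (u i) (v' i) (y i)) :
    M * ∑ v' : Fin N → B, (∏ i, pB (v' i)) * (if z v' then 1 else 0) ≤
      2 * Real.exp (-η) ^ N := by
  have hG : 0 < ∏ i, g (u i) (v i) (y i) := Finset.prod_pos fun _ _ => hg _ _ _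
  have h0 : 0 ≤ ∑ v' : Fin N → B, (∏ i, pB (v' i)) * (if z v' then (1 : ℝ) else 0) :=
    Finset.sum_nonneg fun v' _ =>
      mul_nonneg (Finset.prod_nonneg fun _ _ => hB0 _) (by positivity)
  calc M * ∑ v' : Fin N → B, (∏ i, pB (v' i)) * (if z v' then 1 else 0)
      ≤ 2 * Real.exp (N * R) * (Real.exp (-(N * (m - η))) / (∏ i, g (u i) (v i) (y i)) *
          ∏ i, tiltedSum pB g t (u i) (y i)) :=
        mul_le_mul hM (sum_tilted_le pB hB0 g hg t u y hG z hz) h0 (by positivity)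
    _ = 2 * Real.exp (N * R - N * (m - η) - ∑ i, (Real.log (g (u i) (v i) (y i)) -
          Real.log (tiltedSum pB g t (u i) (y i)))) := by
        rw [prod_eq_exp_sum_log fun i => hg _ _ _,
          prod_eq_exp_sum_log fun i => tiltedSum_pos pB hB0 hB g hg t _ _,
          ← Real.exp_sub, ← Real.exp_add, mul_assoc, ← Real.exp_add, Finset.sum_sub_distrib]
        ring_nf
    _ ≤ 2 * Real.exp (N * -η) := by
        gcongr
        have : (N : ℝ) * (R + 3 * η) ≤ N * (m + μ) := by gcongr
        linarith
    _ = 2 * Real.exp (-η) ^ N := by rw [Real.exp_nat_mul]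

open Classical in
theorem cloud_union_le {A B Y : Type*} [Fintype A] [Fintype B] (pA : A → ℝ) (hA0 : ∀ a, 0 ≤ pA a)
    (hA : ∑ a, pA a = 1) (pB : B → ℝ) (hB0 : ∀ b, 0 ≤ pB b) (hB : ∑ b, pB b = 1)
    (g : A → B → Y → ℝ) (hg : ∀ a b y, 0 < g a b y) (t : A → B → ℝ)
    (u : Fin N → A) (v : Fin N → B) (y : Fin N → Y) {ρ R₀ R₁ m μ η M₀ M₁ : ℝ}
    (hρ0 : 0 ≤ ρ) (hρ1 : ρ ≤ 1) (hη0 : 0 ≤ η) (hM₀ : M₀ ≤ 2 * Real.exp (N * R₀))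
    (hM₁0 : 0 ≤ M₁) (hM₁ : M₁ ≤ 2 * Real.exp (N * R₁))
    (hη : R₀ + ρ * R₁ + 3 * η ≤ ρ * m + μ)
    (hf : N * (μ - η) ≤ ∑ i, (ρ * Real.log (g (u i) (v i) (y i)) -
      Real.log (∑ a, pA a * tiltedSum pB g t a (y i) ^ ρ)))
    (z : (Fin N → A) → (Fin N → B) → Prop)
    (hz : ∀ u' v', z u' v' → N * (m - η) ≤ ∑ i, t (u' i) (v' i) ∧
      ∏ i, g (u i) (v i) (y i) ≤ ∏ i, g (u' i) (v' i) (y i)) :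
    M₀ * ∑ u' : Fin N → A, (∏ i, pA (u' i)) * min 1 (M₁ * ∑ v' : Fin N → B,
      (∏ i, pB (v' i)) * (if z u' v' then 1 else 0)) ≤ 4 * Real.exp (-η) ^ N := by
  have hDpos : ∀ a y, 0 < tiltedSum pB g t a y := tiltedSum_pos pB hB0 hB g hg t
  have hSpos : ∀ y, 0 < ∑ a, pA a * tiltedSum pB g t a y ^ ρ := fun y =>
    sum_weight_pos pA hA0 hA fun a => Real.rpow_pos_of_pos (hDpos a y) ρ
  have hG : 0 < ∏ i, g (u i) (v i) (y i) := Finset.prod_pos fun _ _ => hg _ _ _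
  have h0 : ∀ u', 0 ≤ ∑ v' : Fin N → B, (∏ i, pB (v' i)) * (if z u' v' then (1 : ℝ) else 0) :=
    fun u' => Finset.sum_nonneg fun v' _ =>
      mul_nonneg (Finset.prod_nonneg fun _ _ => hB0 _) (by positivity)
  have hP0 : ∀ u' : Fin N → A, 0 ≤ ∏ i, pA (u' i) := fun u' =>
    Finset.prod_nonneg fun _ _ => hA0 _
  set c := 2 * Real.exp (N * R₁) * (Real.exp (-(N * (m - η))) / ∏ i, g (u i) (v i) (y i))
    with hc
  have hcpos : 0 < c := by positivity
  have hbound : ∀ u' : Fin N → A, min 1 (M₁ * ∑ v' : Fin N → B, (∏ i, pB (v' i)) *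
      (if z u' v' then 1 else 0)) ≤ c ^ ρ * ∏ i, tiltedSum pB g t (u' i) (y i) ^ ρ := by
    intro u'
    refine (min_one_le_rpow (mul_nonneg hM₁0 (h0 u')) hρ0 hρ1).trans ?_
    rw [Real.finsetProd_rpow _ _ fun i _ => (hDpos _ _).le,
      ← Real.mul_rpow hcpos.le (Finset.prod_nonneg fun i _ => (hDpos _ _).le)]
    refine Real.rpow_le_rpow (mul_nonneg hM₁0 (h0 u')) ?_ hρ0
    rw [hc, mul_assoc (2 * _)]
    exact mul_le_mul hM₁ (sum_tilted_le pB hB0 g hg t u' y hG _ (hz u')) (h0 u') (by positivity)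
  have hcle : c ^ ρ ≤ 2 * Real.exp (ρ * (N * R₁ - N * (m - η)) -
      ρ * ∑ i, Real.log (g (u i) (v i) (y i))) := by
    have hc' : c = 2 * Real.exp ((N * R₁ - N * (m - η)) -
        ∑ i, Real.log (g (u i) (v i) (y i))) := by
      rw [hc, prod_eq_exp_sum_log fun i => hg _ _ _, ← Real.exp_sub, mul_assoc, ← Real.exp_add]
      ring_nf
    rw [hc', Real.mul_rpow (by norm_num) (Real.exp_pos _).le, ← Real.exp_mul]
    refine mul_le_mul ?_ (le_of_eq (by ring_nf)) (Real.exp_pos _).le (by norm_num)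
    simpa using Real.rpow_le_rpow_of_exponent_le (by norm_num : (1 : ℝ) ≤ 2) hρ1
  calc M₀ * ∑ u' : Fin N → A, (∏ i, pA (u' i)) * min 1 (M₁ * ∑ v' : Fin N → B,
        (∏ i, pB (v' i)) * (if z u' v' then 1 else 0))
      ≤ 2 * Real.exp (N * R₀) * ∑ u' : Fin N → A, (∏ i, pA (u' i)) *
          (c ^ ρ * ∏ i, tiltedSum pB g t (u' i) (y i) ^ ρ) :=
        mul_le_mul hM₀ (Finset.sum_le_sum fun u' _ =>
          mul_le_mul_of_nonneg_left (hbound u') (hP0 u')) (Finset.sum_nonneg fun u' _ =>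
          mul_nonneg (hP0 u') (le_min zero_le_one (mul_nonneg hM₁0 (h0 u')))) (by positivity)
    _ = 2 * Real.exp (N * R₀) * c ^ ρ * ∏ i, ∑ a, pA a * tiltedSum pB g t a (y i) ^ ρ := by
        rw [← sum_pi_prod fun i a => pA a * tiltedSum pB g t a (y i) ^ ρ, Finset.mul_sum,
          Finset.mul_sum]
        refine Finset.sum_congr rfl fun u' _ => ?_
        rw [Finset.prod_mul_distrib]
        ring
    _ ≤ 2 * Real.exp (N * R₀) * (2 * Real.exp (ρ * (N * R₁ - N * (m - η)) -
          ρ * ∑ i, Real.log (g (u i) (v i) (y i)))) *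
          ∏ i, ∑ a, pA a * tiltedSum pB g t a (y i) ^ ρ := by
        have : 0 < ∏ i, ∑ a, pA a * tiltedSum pB g t a (y i) ^ ρ :=
          Finset.prod_pos fun i _ => hSpos _
        gcongr
    _ = 4 * Real.exp (N * R₀ + ρ * (N * R₁ - N * (m - η)) -
          ∑ i, (ρ * Real.log (g (u i) (v i) (y i)) -
            Real.log (∑ a, pA a * tiltedSum pB g t a (y i) ^ ρ))) := by
        rw [Finset.sum_sub_distrib, ← Finset.mul_sum, prod_eq_exp_sum_log fun i => hSpos (y i),
          show ∀ a b c : ℝ, 2 * a * (2 * b) * c = 4 * (a * b * c) from fun a b c => by ring,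
          ← Real.exp_add, ← Real.exp_add]
        ring_nf
    _ ≤ 4 * Real.exp (N * -η) := by
        gcongr
        have h1 : (N : ℝ) * (R₀ + ρ * R₁ + 3 * η) ≤ N * (ρ * m + μ) := by gcongr
        have h2 : ρ * (N * η) ≤ N * η := mul_le_of_le_one_left (by positivity) hρ1
        linarith
    _ = 4 * Real.exp (-η) ^ N := by rw [Real.exp_nat_mul]

set_option maxHeartbeats 1000000 in
/-- Superposition coding with tilts `t₁`, `t₂`: the sum rate `R₀ + R₁` is achievable under decoding
with the product metric `∏ g`, with vanishing maximal error. -/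
theorem superposition_achievable (pA : A → ℝ) (hA0 : ∀ a, 0 ≤ pA a) (hA : ∑ a, pA a = 1)
    (pB : B → ℝ) (hB0 : ∀ b, 0 ≤ pB b) (hB : ∑ b, pB b = 1)
    (K : A → B → Y → ℝ) (hK0 : ∀ a b y, 0 ≤ K a b y) (hK : ∀ a b, ∑ y, K a b y = 1)
    (g : A → B → Y → ℝ) (hg : ∀ a b y, 0 < g a b y) (t₁ t₂ : A → B → ℝ)
    {ρ R₀ R₁ : ℝ} (hρ0 : 0 ≤ ρ) (hρ1 : ρ ≤ 1) (hR₀ : 0 ≤ R₀) (hR₁ : 0 ≤ R₁)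
    (h₁ : R₁ < ∑ a, pA a * ∑ b, pB b * ∑ y, K a b y * (t₁ a b + (Real.log (g a b y) -
      Real.log (tiltedSum pB g t₁ a y))))
    (h₂ : R₀ + ρ * R₁ < ∑ a, pA a * ∑ b, pB b * ∑ y, K a b y *
      (ρ * t₂ a b + (ρ * Real.log (g a b y) -
      Real.log (∑ a', pA a' * tiltedSum pB g t₂ a' y ^ ρ))))
    {ε : ℝ} (hε : 0 < ε) :
    ∃ N₀ : ℕ, ∀ N : ℕ, N₀ ≤ N → ∃ M : ℕ, ∃ c : Fin M → (Fin N → A) × (Fin N → B),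
      Real.exp (N * (R₀ + R₁)) / 2 ≤ M ∧ ∀ m, ∑ y : Fin N → Y,
        (∏ i, K ((c m).1 i) ((c m).2 i) (y i)) *
          (if ∃ j, j ≠ m ∧ ∏ i, g ((c m).1 i) ((c m).2 i) (y i) ≤
            ∏ i, g ((c j).1 i) ((c j).2 i) (y i) then 1 else 0) ≤ ε := by
  classical
  set f₁ : A → B → Y → ℝ :=
    fun a b y => Real.log (g a b y) - Real.log (tiltedSum pB g t₁ a y) with hf₁
  set f₂ : A → B → Y → ℝ := fun a b y => ρ * Real.log (g a b y) -
    Real.log (∑ a', pA a' * tiltedSum pB g t₂ a' y ^ ρ) with hf₂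
  set mean : (A → B → Y → ℝ) → ℝ :=
    fun f => ∑ a, pA a * ∑ b, pB b * ∑ y, K a b y * f a b y with hmean
  set m₁ := mean fun a b _ => t₁ a b with hm₁
  set m₂ := mean fun a b _ => t₂ a b with hm₂
  have e₁ : R₁ < m₁ + mean f₁ := by
    refine h₁.trans_eq ?_
    simp only [hm₁, hmean, mul_add, Finset.sum_add_distrib, hf₁]
  have e₂ : R₀ + ρ * R₁ < ρ * m₂ + mean f₂ := by
    refine h₂.trans_eq ?_
    simp only [hm₂, hmean, mul_add, Finset.sum_add_distrib, hf₂, Finset.mul_sum,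
      mul_left_comm ρ]
  obtain ⟨η, hη, hη₁, hη₂⟩ : ∃ η : ℝ, 0 < η ∧ R₁ + 3 * η ≤ m₁ + mean f₁ ∧
      R₀ + ρ * R₁ + 3 * η ≤ ρ * m₂ + mean f₂ := by
    refine ⟨min (m₁ + mean f₁ - R₁) (ρ * m₂ + mean f₂ - (R₀ + ρ * R₁)) / 3, ?_, ?_, ?_⟩
    · have : 0 < min (m₁ + mean f₁ - R₁) (ρ * m₂ + mean f₂ - (R₀ + ρ * R₁)) :=
        lt_min (by linarith) (by linarith)
      positivity
    · linarith [min_le_left (m₁ + mean f₁ - R₁) (ρ * m₂ + mean f₂ - (R₀ + ρ * R₁))]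
    · linarith [min_le_right (m₁ + mean f₁ - R₁) (ρ * m₂ + mean f₂ - (R₀ + ρ * R₁))]
  have tail := fun f => exists_tail_bound pA hA0 hA pB hB0 hB K hK0 hK f hη
  obtain ⟨r₁, hr₁, hr₁', T₁⟩ := tail fun a b _ => t₁ a b
  obtain ⟨r₂, hr₂, hr₂', T₂⟩ := tail fun a b _ => t₂ a b
  obtain ⟨r₃, hr₃, hr₃', T₃⟩ := tail f₁
  obtain ⟨r₄, hr₄, hr₄', T₄⟩ := tail f₂
  set ε' := min ε (1 / 2) with hε'
  have hε'0 : 0 < ε' := lt_min hε (by norm_num)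
  have hlim : Tendsto (fun N : ℕ => (r₁ ^ N + r₂ ^ N + r₃ ^ N + r₄ ^ N) +
      2 * Real.exp (-η) ^ N + 4 * Real.exp (-η) ^ N) atTop (𝓝 0) := by
    have hexp : Tendsto (fun N : ℕ => Real.exp (-η) ^ N) atTop (𝓝 0) :=
      tendsto_pow_atTop_nhds_zero_of_lt_one (Real.exp_pos _).le (by simpa using hη)
    simpa using ((((tendsto_pow_atTop_nhds_zero_of_lt_one hr₁ hr₁').add
      (tendsto_pow_atTop_nhds_zero_of_lt_one hr₂ hr₂')).add
      (tendsto_pow_atTop_nhds_zero_of_lt_one hr₃ hr₃')).add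
      (tendsto_pow_atTop_nhds_zero_of_lt_one hr₄ hr₄')).add (hexp.const_mul 2) |>.add
      (hexp.const_mul 4)
  obtain ⟨N₀, hN₀⟩ := eventually_atTop.1 (hlim.eventually (gt_mem_nhds (half_pos hε'0)))
  refine ⟨N₀, fun N hN => ?_⟩
  have hsmall := hN₀ N hN
  set M₀ := ⌈Real.exp (N * R₀)⌉₊ with hM₀
  set M₁ := ⌈Real.exp (N * R₁)⌉₊ with hM₁
  have hM₀le : (M₀ : ℝ) ≤ 2 * Real.exp (N * R₀) := ceil_exp_le (by positivity)
  have hM₁le : (M₁ : ℝ) ≤ 2 * Real.exp (N * R₁) := ceil_exp_le (by positivity)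
  set P : (Fin N → A) → ℝ := fun u => ∏ i, pA (u i) with hP
  set R : (Fin N → B) → ℝ := fun v => ∏ i, pB (v i) with hR
  set KN : (Fin N → A) → (Fin N → B) → (Fin N → Y) → ℝ :=
    fun u v y => ∏ i, K (u i) (v i) (y i) with hKN
  set G : (Fin N → A) → (Fin N → B) → (Fin N → Y) → ℝ :=
    fun u v y => ∏ i, g (u i) (v i) (y i) with hG
  have hP0 : ∀ u, 0 ≤ P u := fun u => Finset.prod_nonneg fun _ _ => hA0 _
  have hRR0 : ∀ v, 0 ≤ R v := fun v => Finset.prod_nonneg fun _ _ => hB0 _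
  have hKN0 : ∀ u v y, 0 ≤ KN u v y := fun u v y => Finset.prod_nonneg fun _ _ => hK0 _ _ _
  have hKN1 : ∀ u v, ∑ y, KN u v y = 1 := fun u v => by
    rw [hKN, sum_pi_prod fun i y => K (u i) (v i) y]
    simp [hK]
  have hGpos : ∀ u v y, 0 < G u v y := fun u v y => Finset.prod_pos fun _ _ => hg _ _ _
  set low : (A → B → Y → ℝ) → (Fin N → A) × (Fin N → B) → (Fin N → Y) → Prop :=
    fun f w y => ∑ i, f (w.1 i) (w.2 i) (y i) < N * (mean f - η) with hlow
  set good : (Fin N → A) × (Fin N → B) → Prop := fun w =>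
    N * (m₁ - η) ≤ ∑ i, t₁ (w.1 i) (w.2 i) ∧ N * (m₂ - η) ≤ ∑ i, t₂ (w.1 i) (w.2 i) with hgood
  obtain ⟨T, hTdef⟩ : ∃ T : (Fin N → A) × (Fin N → B) → (Fin N → Y) → Prop, ∀ w y, T w y ↔
      (low (fun a b _ => t₁ a b) w y ∨ low (fun a b _ => t₂ a b) w y ∨ low f₁ w y ∨ low f₂ w y) :=
    ⟨_, fun _ _ => Iff.rfl⟩
  obtain ⟨Z, hZ⟩ : ∃ Z : (Fin N → A) × (Fin N → B) → (Fin N → A) × (Fin N → B) →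
      (Fin N → Y) → Prop, Z = fun m j y => good j ∧ G m.1 m.2 y ≤ G j.1 j.2 y := ⟨_, rfl⟩
  have hZ' : ∀ m j y, Z m j y → good j ∧ G m.1 m.2 y ≤ G j.1 j.2 y := fun m j y h => by
    rwa [hZ] at h
  have hT : ∑ u, P u * ∑ v, R v * ∑ y, KN u v y * (if T (u, v) y then 1 else 0) ≤
      r₁ ^ N + r₂ ^ N + r₃ ^ N + r₄ ^ N := by
    refine le_trans ?_ (add_le_add (add_le_add (add_le_add (T₁ N) (T₂ N)) (T₃ N)) (T₄ N))
    simp only [← Finset.sum_add_distrib, ← mul_add]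
    gcongr with u _ v _ y _
    · exact hP0 u
    · exact hRR0 v
    · exact hKN0 u v y
    · have nn : ∀ p : Prop, [Decidable p] → (0 : ℝ) ≤ if p then 1 else 0 :=
        fun p _ => by positivity
      have n1 := nn (low (fun a b _ => t₁ a b) (u, v) y)
      have n2 := nn (low (fun a b _ => t₂ a b) (u, v) y)
      have n3 := nn (low f₁ (u, v) y)
      have n4 := nn (low f₂ (u, v) y)
      change (if T (u, v) y then (1 : ℝ) else 0) ≤
        (if low (fun a b _ => t₁ a b) (u, v) y then (1 : ℝ) else 0) +
        (if low (fun a b _ => t₂ a b) (u, v) y then (1 : ℝ) else 0) +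
        (if low f₁ (u, v) y then (1 : ℝ) else 0) + (if low f₂ (u, v) y then (1 : ℝ) else 0)
      by_cases h : T (u, v) y
      · rw [if_pos h]
        rcases (hTdef _ _).1 h with h | h | h | h <;> rw [if_pos h] <;> linarith
      · rw [if_neg h]
        linarith
  have hsat : ∀ u v y, ¬ T (u, v) y →
      Fintype.card (Fin M₁) * ∑ v', R v' * (if Z (u, v) (u, v') y then 1 else 0) ≤
        2 * Real.exp (-η) ^ N := by
    intro u v y hty
    rw [Fintype.card_fin]
    refine satellite_union_le pB hB0 hB g hg t₁ u v y hM₁le hη₁ ?_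
      (fun v' => Z (u, v) (u, v') y) fun v' hv' => ⟨(hZ' _ _ _ hv').1.1, (hZ' _ _ _ hv').2⟩
    exact not_lt.1 fun h => hty ((hTdef _ _).2 (Or.inr (Or.inr (Or.inl h))))
  have hcloud : ∀ u v y, ¬ T (u, v) y →
      Fintype.card (Fin M₀) * ∑ u', P u' * min 1 (Fintype.card (Fin M₁) *
        ∑ v', R v' * (if Z (u, v) (u', v') y then 1 else 0)) ≤ 4 * Real.exp (-η) ^ N := by
    intro u v y hty
    rw [Fintype.card_fin, Fintype.card_fin]
    refine cloud_union_le pA hA0 hA pB hB0 hB g hg t₂ u v y hρ0 hρ1 hη.le hM₀le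
      (Nat.cast_nonneg _) hM₁le hη₂ ?_
      (fun u' v' => Z (u, v) (u', v') y) fun u' v' hv' =>
        ⟨(hZ' _ _ _ hv').1.2, (hZ' _ _ _ hv').2⟩
    exact not_lt.1 fun h => hty ((hTdef _ _).2 (Or.inr (Or.inr (Or.inr h))))
  obtain ⟨C, hC⟩ := exists_superposition_code (ι := Fin M₀) (κ := Fin M₁) P hP0
    (sum_iid_eq_one pA hA) R hRR0 (sum_iid_eq_one pB hB) KN hKN0 hKN1 T Z
    (by positivity) (by positivity) hT hsat hcloud
  subst hZ
  have hgT : ∀ w y, ¬ good w → T w y := by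
    intro w y hw
    rcases not_and_or.1 hw with h | h
    · exact (hTdef _ _).2 (Or.inl (not_le.1 h))
    · exact (hTdef _ _).2 (Or.inr (Or.inl (not_le.1 h)))
  obtain ⟨M, c, hM, hc⟩ := exists_subcode KN hKN0 hKN1 G good T hgT C hε'0
    ((min_le_right _ _).trans_lt (by norm_num))
    (hC.trans (mul_le_mul_of_nonneg_left hsmall.le (Nat.cast_nonneg _)))
  refine ⟨M, c, le_trans ?_ hM, fun m => ?_⟩
  · rw [Fintype.card_prod, Fintype.card_fin, Fintype.card_fin, Nat.cast_mul, mul_add,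
      Real.exp_add]
    gcongr
    · exact Nat.le_ceil _
    · exact Nat.le_ceil _
  · refine le_trans (le_of_eq (Finset.sum_congr rfl fun y _ => ?_))
      ((hc m).trans (min_le_left _ _))
    congr

end SuperpositionCoding

section PairEnsemble

/-- The input letters of a pair, indexed by cloud letter and satellite letter. -/
def pairInput : Fin 2 → Fin 3 → Fin 2 × Fin 2 :=
  ![fun _ => (1, 1), ![(0, 0), (0, 1), (1, 0)]]

noncomputable def cloudLaw : Fin 2 → ℝ := ![0.12, 0.88]

noncomputable def satelliteLaw : Fin 3 → ℝ := ![0.65, 0.175, 0.175]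

noncomputable def pairChannel (a : Fin 2) (b : Fin 3) (y : Fin 3 × Fin 3) : ℝ :=
  W (pairInput a b).1 y.1 * W (pairInput a b).2 y.2

/-- The decoding metric of a pair, raised to the power ten. -/
noncomputable def pairMetric (a : Fin 2) (b : Fin 3) (y : Fin 3 × Fin 3) : ℝ :=
  (q (pairInput a b).1 y.1 * q (pairInput a b).2 y.2) ^ 10

noncomputable def satelliteTilt : Fin 2 → Fin 3 → ℝ := ![![1, 1, 1], ![2, 1, 1]]

noncomputable def cloudTilt : Fin 2 → Fin 3 → ℝ := ![![1, 1, 1], ![4, 1.6, 1.6]]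

/-- Rational lower bounds for `log q`. -/
noncomputable def logMetricLower : Fin 2 → Fin 3 → ℝ :=
  ![![0, 0, 0], ![0, -0.6931472, 0.3074846]]

noncomputable def logSatelliteTiltLower : Fin 2 → Fin 3 → ℝ := ![![0, 0, 0], ![0.6931471, 0, 0]]

noncomputable def logCloudTiltLower : Fin 2 → Fin 3 → ℝ :=
  ![![0, 0, 0], ![1.3862942, 0.4700036, 0.4700036]]

/-- Rational upper bounds for the logarithm of the satellite partition function at `a = 1`. -/
noncomputable def logSatelliteSumUpper : Fin 3 → Fin 3 → ℝ :=
  ![![0.50078, 0.38878, 1.66073], ![0.38878, 0.26263, 1.62695], ![1.66073, 1.62695, 2.18339]]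

/-- Rational upper bounds for the square root of the cloud partition function at `a = 1`. -/
noncomputable def sqrtCloudSumUpper : Fin 3 → Fin 3 → ℝ :=
  ![![1.77764, 1.69714, 2.99016], ![1.69714, 1.61263, 2.94302], ![2.99016, 2.94302, 3.83694]]

/-- Rational upper bounds for the logarithm of the `ρ = 1 / 2` mixture of partition functions. -/
noncomputable def logMixtureUpper : Fin 3 → Fin 3 → ℝ :=
  ![![0.52137, 0.40362, 1.15992], ![0.40362, 0.35012, 0.95832], ![1.15992, 0.95832, 1.78744]]

theorem W_nonneg (x : Fin 2) (y : Fin 3) : 0 ≤ W x y := by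
  fin_cases x <;> fin_cases y <;> norm_num [W]

theorem sum_W (x : Fin 2) : ∑ y, W x y = 1 := by
  fin_cases x <;> norm_num [W, Fin.sum_univ_succ]

theorem q_pos (x : Fin 2) (y : Fin 3) : 0 < q x y := by
  fin_cases x <;> fin_cases y <;> norm_num [q]

theorem cloudLaw_nonneg (a : Fin 2) : 0 ≤ cloudLaw a := by
  fin_cases a <;> norm_num [cloudLaw]

theorem satelliteLaw_nonneg (b : Fin 3) : 0 ≤ satelliteLaw b := by
  fin_cases b <;> norm_num [satelliteLaw]

theorem sum_cloudLaw : ∑ a, cloudLaw a = 1 := by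
  norm_num [cloudLaw, Fin.sum_univ_succ]

theorem sum_satelliteLaw : ∑ b, satelliteLaw b = 1 := by
  norm_num [satelliteLaw, Fin.sum_univ_succ]

theorem pairChannel_nonneg (a : Fin 2) (b : Fin 3) (y : Fin 3 × Fin 3) :
    0 ≤ pairChannel a b y :=
  mul_nonneg (W_nonneg _ _) (W_nonneg _ _)

theorem sum_pairChannel (a : Fin 2) (b : Fin 3) : ∑ y, pairChannel a b y = 1 := by
  simp only [pairChannel, Fintype.sum_prod_type, ← Finset.mul_sum, sum_W, mul_one]

theorem pairMetric_pos (a : Fin 2) (b : Fin 3) (y : Fin 3 × Fin 3) : 0 < pairMetric a b y :=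
  pow_pos (mul_pos (q_pos _ _) (q_pos _ _)) _

theorem satelliteTilt_pos (a : Fin 2) (b : Fin 3) : 0 < satelliteTilt a b := by
  fin_cases a <;> fin_cases b <;> norm_num [satelliteTilt]

theorem cloudTilt_pos (a : Fin 2) (b : Fin 3) : 0 < cloudTilt a b := by
  fin_cases a <;> fin_cases b <;> norm_num [cloudTilt]

theorem log_le_of_le_pow {x c : ℝ} (hx : 0 < x) (hc : 0 ≤ c)
    (h : x ≤ (∑ i ∈ Finset.range 7, (c / 8) ^ i / i.factorial) ^ 8) : Real.log x ≤ c := by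
  rw [Real.log_le_iff_le_exp hx]
  calc x ≤ _ := h
    _ ≤ Real.exp (c / 8) ^ 8 := by
        gcongr
        exact Real.sum_le_exp_of_nonneg (by positivity) 7
    _ = Real.exp c := by rw [← Real.exp_nat_mul]; congr 1; push_cast; ring

theorem le_log_of_sum_le {x c : ℝ} (hx : 0 < x) (hc0 : 0 ≤ c) (hc1 : c ≤ 1)
    (h : (∑ i ∈ Finset.range 9, c ^ i / i.factorial) + c ^ 9 * 10 / (Nat.factorial 9 * 9) ≤ x) :
    c ≤ Real.log x := by
  rw [Real.le_log_iff_exp_le hx]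
  refine le_trans ?_ h
  have := Real.exp_bound' hc0 hc1 (n := 9) (by norm_num)
  norm_num at this ⊢
  linarith

theorem logMetricLower_le (x : Fin 2) (y : Fin 3) : logMetricLower x y ≤ Real.log (q x y) := by
  have h₂ : Real.log 0.5 = -Real.log 2 := by
    rw [← Real.log_inv]
    norm_num
  have h₃ : 0.3074846 ≤ Real.log 1.36 := by
    refine le_log_of_sum_le (by norm_num) (by norm_num) (by norm_num) ?_
    norm_num [Finset.sum_range_succ, Nat.factorial]
  have := Real.log_two_lt_d9
  fin_cases x <;> fin_cases y <;> simp [logMetricLower, q] <;> linarith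

theorem logSatelliteTiltLower_le (a : Fin 2) (b : Fin 3) :
    logSatelliteTiltLower a b ≤ Real.log (satelliteTilt a b) := by
  have := Real.log_two_gt_d9
  fin_cases a <;> fin_cases b <;> simp [logSatelliteTiltLower, satelliteTilt]
  linarith

theorem logCloudTiltLower_le (a : Fin 2) (b : Fin 3) :
    logCloudTiltLower a b ≤ Real.log (cloudTilt a b) := by
  have h₁ : 0.4700036 ≤ Real.log 1.6 := by
    refine le_log_of_sum_le (by norm_num) (by norm_num) (by norm_num) ?_
    norm_num [Finset.sum_range_succ, Nat.factorial]
  have h₂ : Real.log 4 = 2 * Real.log 2 := by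
    rw [show (4 : ℝ) = 2 ^ 2 by norm_num, Real.log_pow]
    norm_num
  have := Real.log_two_gt_d9
  fin_cases a <;> fin_cases b <;> simp [logCloudTiltLower, cloudTilt] <;> linarith

theorem le_log_pairMetric (a : Fin 2) (b : Fin 3) (y : Fin 3 × Fin 3) :
    10 * (logMetricLower (pairInput a b).1 y.1 + logMetricLower (pairInput a b).2 y.2) ≤
      Real.log (pairMetric a b y) := by
  rw [pairMetric, Real.log_pow, Real.log_mul (q_pos _ _).ne' (q_pos _ _).ne']
  push_cast
  linarith [logMetricLower_le (pairInput a b).1 y.1, logMetricLower_le (pairInput a b).2 y.2]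

theorem tiltedSum_log (g : Fin 2 → Fin 3 → Fin 3 × Fin 3 → ℝ) {e : Fin 2 → Fin 3 → ℝ}
    (he : ∀ a b, 0 < e a b) (a : Fin 2) (y : Fin 3 × Fin 3) :
    tiltedSum satelliteLaw g (fun a b => Real.log (e a b)) a y =
      ∑ b, satelliteLaw b * (g a b y * e a b) := by
  simp only [tiltedSum, Real.exp_log (he _ _)]

theorem tiltedSum_satellite_zero (b : Fin 3) (y : Fin 3 × Fin 3) :
    tiltedSum satelliteLaw pairMetric (fun a b => Real.log (satelliteTilt a b)) 0 y =
      pairMetric 0 b y := by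
  rw [tiltedSum_log _ satelliteTilt_pos]
  simp [Fin.sum_univ_succ, satelliteLaw, pairMetric, pairInput, satelliteTilt]
  ring

theorem log_tiltedSum_satellite_one_le (y : Fin 3 × Fin 3) :
    Real.log (tiltedSum satelliteLaw pairMetric (fun a b => Real.log (satelliteTilt a b)) 1 y) ≤
      logSatelliteSumUpper y.1 y.2 := by
  have hpos : 0 < tiltedSum satelliteLaw pairMetric (fun a b => Real.log (satelliteTilt a b)) 1 y :=
    tiltedSum_pos _ satelliteLaw_nonneg sum_satelliteLaw _ pairMetric_pos _ _ _
  rw [tiltedSum_log _ satelliteTilt_pos] at hpos ⊢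
  refine log_le_of_le_pow hpos ?_ ?_
  · obtain ⟨i, j⟩ := y
    fin_cases i <;> fin_cases j <;> norm_num [logSatelliteSumUpper]
  · obtain ⟨i, j⟩ := y
    fin_cases i <;> fin_cases j <;>
      norm_num [Fin.sum_univ_succ, Finset.sum_range_succ, Nat.factorial, satelliteLaw, pairMetric,
        pairInput, satelliteTilt, q, logSatelliteSumUpper]

theorem rpow_half_le {x s : ℝ} (hs : 0 ≤ s) (h : x ≤ s ^ 2) : x ^ (1 / 2 : ℝ) ≤ s := by
  rw [← Real.sqrt_eq_rpow]
  exact Real.sqrt_le_iff.2 ⟨hs, h⟩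

theorem mixture_le (y : Fin 3 × Fin 3) :
    ∑ a, cloudLaw a * tiltedSum satelliteLaw pairMetric
      (fun a b => Real.log (cloudTilt a b)) a y ^ (1 / 2 : ℝ) ≤
        0.12 * (q 1 y.1 * q 1 y.2) ^ 5 + 0.88 * sqrtCloudSumUpper y.1 y.2 := by
  have h0 : tiltedSum satelliteLaw pairMetric
      (fun a b => Real.log (cloudTilt a b)) 0 y ^ (1 / 2 : ℝ) ≤ (q 1 y.1 * q 1 y.2) ^ 5 := by
    refine rpow_half_le (pow_pos (mul_pos (q_pos _ _) (q_pos _ _)) _).le (le_of_eq ?_)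
    rw [tiltedSum_log _ cloudTilt_pos]
    simp [Fin.sum_univ_succ, satelliteLaw, pairMetric, pairInput, cloudTilt]
    ring
  have h1 : tiltedSum satelliteLaw pairMetric
      (fun a b => Real.log (cloudTilt a b)) 1 y ^ (1 / 2 : ℝ) ≤ sqrtCloudSumUpper y.1 y.2 := by
    rw [tiltedSum_log _ cloudTilt_pos]
    obtain ⟨i, j⟩ := y
    apply rpow_half_le
    · fin_cases i <;> fin_cases j <;> norm_num [sqrtCloudSumUpper]
    · fin_cases i <;> fin_cases j <;>
        norm_num [Fin.sum_univ_succ, satelliteLaw, pairMetric, pairInput, cloudTilt, q,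
          sqrtCloudSumUpper]
  simp only [Fin.sum_univ_two, cloudLaw, Matrix.cons_val_zero, Matrix.cons_val_one]
  gcongr

theorem log_mixture_le (y : Fin 3 × Fin 3) :
    Real.log (∑ a, cloudLaw a * tiltedSum satelliteLaw pairMetric
      (fun a b => Real.log (cloudTilt a b)) a y ^ (1 / 2 : ℝ)) ≤ logMixtureUpper y.1 y.2 := by
  have hpos : 0 < ∑ a, cloudLaw a * tiltedSum satelliteLaw pairMetric
      (fun a b => Real.log (cloudTilt a b)) a y ^ (1 / 2 : ℝ) :=
    sum_weight_pos _ cloudLaw_nonneg sum_cloudLaw fun a => Real.rpow_pos_of_pos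
      (tiltedSum_pos _ satelliteLaw_nonneg sum_satelliteLaw _ pairMetric_pos _ _ _) _
  refine log_le_of_le_pow hpos ?_ ((mixture_le y).trans ?_)
  · obtain ⟨i, j⟩ := y
    fin_cases i <;> fin_cases j <;> norm_num [logMixtureUpper]
  · obtain ⟨i, j⟩ := y
    fin_cases i <;> fin_cases j <;>
      norm_num [Finset.sum_range_succ, Nat.factorial, q, sqrtCloudSumUpper, logMixtureUpper]

theorem satellite_rate_lt : 0.2214 < ∑ a, cloudLaw a * ∑ b, satelliteLaw b *
    ∑ y, pairChannel a b y * (Real.log (satelliteTilt a b) + (Real.log (pairMetric a b y) -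
      Real.log (tiltedSum satelliteLaw pairMetric
        (fun a b => Real.log (satelliteTilt a b)) a y))) := by
  have h0 : ∀ b y, (0 : ℝ) ≤ Real.log (satelliteTilt 0 b) + (Real.log (pairMetric 0 b y) -
      Real.log (tiltedSum satelliteLaw pairMetric
        (fun a b => Real.log (satelliteTilt a b)) 0 y)) := fun b y => by
    rw [tiltedSum_satellite_zero b y, sub_self, add_zero]
    refine le_trans ?_ (logSatelliteTiltLower_le 0 b)
    fin_cases b <;> norm_num [logSatelliteTiltLower]
  have h1 : ∀ b y, logSatelliteTiltLower 1 b + (10 * (logMetricLower (pairInput 1 b).1 y.1 +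
      logMetricLower (pairInput 1 b).2 y.2) - logSatelliteSumUpper y.1 y.2) ≤
      Real.log (satelliteTilt 1 b) + (Real.log (pairMetric 1 b y) -
      Real.log (tiltedSum satelliteLaw pairMetric
        (fun a b => Real.log (satelliteTilt a b)) 1 y)) := fun b y => by
    linarith [logSatelliteTiltLower_le 1 b, le_log_pairMetric 1 b y,
      log_tiltedSum_satellite_one_le y]
  have hnum : 0.2214 < cloudLaw 1 * ∑ b, satelliteLaw b * ∑ y, pairChannel 1 b y *
      (logSatelliteTiltLower 1 b + (10 * (logMetricLower (pairInput 1 b).1 y.1 +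
        logMetricLower (pairInput 1 b).2 y.2) - logSatelliteSumUpper y.1 y.2)) := by
    norm_num [Fin.sum_univ_succ, Fintype.sum_prod_type, cloudLaw, satelliteLaw, pairChannel,
      pairInput, W, logSatelliteTiltLower, logMetricLower, logSatelliteSumUpper]
  rw [Fin.sum_univ_two]
  refine hnum.trans_le (le_add_of_nonneg_of_le ?_ ?_)
  · exact mul_nonneg (cloudLaw_nonneg _) (Finset.sum_nonneg fun b _ =>
      mul_nonneg (satelliteLaw_nonneg _) (Finset.sum_nonneg fun y _ =>
        mul_nonneg (pairChannel_nonneg _ _ _) (h0 b y)))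
  · exact mul_le_mul_of_nonneg_left (Finset.sum_le_sum fun b _ =>
      mul_le_mul_of_nonneg_left (Finset.sum_le_sum fun y _ =>
        mul_le_mul_of_nonneg_left (h1 b y) (pairChannel_nonneg _ _ _)) (satelliteLaw_nonneg _))
        (cloudLaw_nonneg _)

theorem cloud_rate_lt : 0.0547 + (1 / 2 : ℝ) * 0.2214 < ∑ a, cloudLaw a * ∑ b, satelliteLaw b *
    ∑ y, pairChannel a b y * (1 / 2 * Real.log (cloudTilt a b) +
      (1 / 2 * Real.log (pairMetric a b y) - Real.log (∑ a', cloudLaw a' * tiltedSum satelliteLaw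
        pairMetric (fun a b => Real.log (cloudTilt a b)) a' y ^ (1 / 2 : ℝ)))) := by
  have hnum : 0.0547 + (1 / 2 : ℝ) * 0.2214 < ∑ a, cloudLaw a * ∑ b, satelliteLaw b *
      ∑ y, pairChannel a b y * (1 / 2 * logCloudTiltLower a b + (1 / 2 *
        (10 * (logMetricLower (pairInput a b).1 y.1 + logMetricLower (pairInput a b).2 y.2)) -
          logMixtureUpper y.1 y.2)) := by
    norm_num [Fin.sum_univ_succ, Fintype.sum_prod_type, cloudLaw, satelliteLaw, pairChannel,
      pairInput, W, logCloudTiltLower, logMetricLower, logMixtureUpper]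
  refine hnum.trans_le (Finset.sum_le_sum fun a _ => mul_le_mul_of_nonneg_left
    (Finset.sum_le_sum fun b _ => mul_le_mul_of_nonneg_left (Finset.sum_le_sum fun y _ =>
      mul_le_mul_of_nonneg_left ?_ (pairChannel_nonneg _ _ _)) (satelliteLaw_nonneg _))
        (cloudLaw_nonneg _))
  linarith [logCloudTiltLower_le a b, le_log_pairMetric a b y, log_mixture_le y]

end PairEnsemble

section BlockTransfer

/-- A word of length `2 * N` as a word of `N` pairs of letters. -/
def unpairWord (α : Type*) (N : ℕ) : (Fin N → α × α) ≃ (Fin (N * 2) → α) :=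
  (Equiv.arrowCongr (Equiv.refl _) (finTwoArrowEquiv α).symm).trans
    ((Equiv.curry (Fin N) (Fin 2) α).symm.trans
      (Equiv.arrowCongr finProdFinEquiv (Equiv.refl _)))

theorem prod_unpairWord {α β : Type*} {N : ℕ} (f : α → β → ℝ) (x : Fin N → α × α)
    (y : Fin N → β × β) :
    ∏ k, f (unpairWord α N x k) (unpairWord β N y k) =
      ∏ i, f (x i).1 (y i).1 * f (x i).2 (y i).2 := by
  rw [← finProdFinEquiv.prod_comp, Fintype.prod_prod_type]
  refine Finset.prod_congr rfl fun i _ => ?_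
  simp [unpairWord, Fin.prod_univ_two, Function.uncurry, Equiv.arrowCongr]

theorem pe_le_of_forall {n M : ℕ} {c : Fin M → Fin n → Fin 2} {ε : ℝ} (hε : 0 ≤ ε)
    (h : ∀ m, ∑ y : Fin n → Fin 3, Wn n (c m) y *
      (if ∃ j : Fin M, j ≠ m ∧ qn n (c m) y ≤ qn n (c j) y then 1 else 0) ≤ ε) :
    pe n M c ≤ ε := by
  have hsum := Finset.sum_le_sum fun m (_ : m ∈ Finset.univ) => h m
  rw [Finset.sum_const, Finset.card_univ, Fintype.card_fin, nsmul_eq_mul] at hsum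
  rw [pe, one_div]
  rcases Nat.eq_zero_or_pos M with rfl | hM
  · simpa using hε
  · exact (inv_mul_le_iff₀ (Nat.cast_pos.2 hM)).2 hsum

/-- Prepending a constant letter, on which the metric is constant, keeps the error probability. -/
theorem pe_cons (n M : ℕ) (c : Fin M → Fin n → Fin 2) :
    pe (n + 1) M (fun m => Fin.cons 0 (c m)) = pe n M c := by
  have hq : ∀ y, q 0 y = 1 := fun y => by fin_cases y <;> simp [q]
  unfold pe
  congr 1
  refine Finset.sum_congr rfl fun m _ => ?_
  rw [← (Fin.consEquiv fun _ => Fin 3).sum_comp, Fintype.sum_prod_type]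
  simp only [Fin.consEquiv_apply, Wn, qn, Fin.prod_univ_succ, Fin.cons_zero, Fin.cons_succ, hq,
    one_mul, mul_assoc, ← Finset.mul_sum]
  rw [← Finset.sum_mul, sum_W, one_mul]
  congr!

theorem exists_pair_code {ε : ℝ} (hε : 0 < ε) : ∃ N₀ : ℕ, ∀ N : ℕ, N₀ ≤ N →
    ∃ M : ℕ, ∃ c : Fin M → Fin (N * 2) → Fin 2,
      Real.exp (N * 0.2761) / 2 ≤ M ∧ pe (N * 2) M c ≤ ε := by
  obtain ⟨N₀, hN₀⟩ := superposition_achievable cloudLaw cloudLaw_nonneg sum_cloudLaw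
    satelliteLaw satelliteLaw_nonneg sum_satelliteLaw pairChannel pairChannel_nonneg
    sum_pairChannel pairMetric pairMetric_pos (fun a b => Real.log (satelliteTilt a b))
    (fun a b => Real.log (cloudTilt a b)) (by norm_num) (by norm_num) (by norm_num) (by norm_num)
    satellite_rate_lt cloud_rate_lt hε
  refine ⟨N₀, fun N hN => ?_⟩
  obtain ⟨M, c, hM, hc⟩ := hN₀ N hN
  set word : Fin M → Fin N → Fin 2 × Fin 2 := fun m i => pairInput ((c m).1 i) ((c m).2 i)
    with hword
  refine ⟨M, fun m => unpairWord _ N (word m), by norm_num at hM ⊢; exact hM,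
    pe_le_of_forall hε.le fun m => ?_⟩
  have hW : ∀ y, Wn (N * 2) (unpairWord _ N (word m)) (unpairWord _ N y) =
      ∏ i, pairChannel ((c m).1 i) ((c m).2 i) (y i) := fun y =>
    prod_unpairWord W (word m) y
  have hq : ∀ j y, qn (N * 2) (unpairWord _ N (word j)) (unpairWord _ N y) ^ 10 =
      ∏ i, pairMetric ((c j).1 i) ((c j).2 i) (y i) := fun j y => by
    rw [qn, prod_unpairWord q (word j) y, ← Finset.prod_pow]
    rfl
  have hle : ∀ j y, qn (N * 2) (unpairWord _ N (word m)) (unpairWord _ N y) ≤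
      qn (N * 2) (unpairWord _ N (word j)) (unpairWord _ N y) ↔
      ∏ i, pairMetric ((c m).1 i) ((c m).2 i) (y i) ≤
        ∏ i, pairMetric ((c j).1 i) ((c j).2 i) (y i) := fun j y => by
    rw [← hq, ← hq]
    exact (pow_le_pow_iff_left₀ (Finset.prod_nonneg fun _ _ => (q_pos _ _).le)
      (Finset.prod_nonneg fun _ _ => (q_pos _ _).le) (by norm_num)).symm
  rw [← (unpairWord (Fin 3) N).sum_comp]
  simp only [hW, hle]
  exact hc m

theorem exp_le_half_exp {n N : ℕ} (hN : 11000 ≤ N) (hn : n ≤ 2 * N + 1) {δ : ℝ} (hδ : 0 ≤ δ) :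
    Real.exp (n * (0.137998 - δ)) ≤ Real.exp (N * 0.2761) / 2 := by
  have hN' : (11000 : ℝ) ≤ N := by exact_mod_cast hN
  have hn' : (n : ℝ) ≤ 2 * N + 1 := by exact_mod_cast hn
  have hδn : 0 ≤ (n : ℝ) * δ := by positivity
  rw [le_div_iff₀ two_pos]
  calc Real.exp (n * (0.137998 - δ)) * 2
      ≤ Real.exp (n * (0.137998 - δ)) * Real.exp 1 := by
        gcongr
        linarith [Real.add_one_le_exp 1]
    _ ≤ Real.exp (N * 0.2761) := by
        rw [← Real.exp_add, Real.exp_le_exp]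
        linarith

end BlockTransfer

/-- The rate `0.137998` nats/use is achievable for `(W,q)` under mismatched decoding. -/
theorem rate_achievable :
    ∀ δ : ℝ, 0 < δ → ∀ ε : ℝ, 0 < ε → ∃ N : ℕ, ∀ n : ℕ, N ≤ n →
      ∃ M : ℕ, ∃ c : Fin M → Fin n → Fin 2,
        Real.exp (n * (0.137998 - δ)) ≤ (M : ℝ) ∧ pe n M c ≤ ε := by
  intro δ hδ ε hε
  obtain ⟨N₀, hN₀⟩ := exists_pair_code hε
  refine ⟨2 * (N₀ + 11000), fun n hn => ?_⟩
  obtain ⟨M, c, hM, hc⟩ := hN₀ (n / 2) (by lia)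
  have hexp := (exp_le_half_exp (n := n) (N := n / 2) (by lia) (by lia) hδ.le).trans hM
  obtain h | h : n = n / 2 * 2 ∨ n = n / 2 * 2 + 1 := by lia
  · generalize n / 2 = N at h c
    subst h
    exact ⟨M, c, hexp, hc⟩
  · generalize n / 2 = N at h c
    subst h
    exact ⟨M, fun m => Fin.cons 0 (c m), hexp, (pe_cons _ M c).trans_le hc⟩
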